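/- arXiv:2508.13963 — 10 statements merged into one kernel-verified Lean document; each statement's English description precedes it below -/
import Mathlib

section
/- Let n be a finite nonempty index set and let P be an n×n real matrix with nonnegative entries whose row sums are at most 1. Suppose that for some positive integer m every row sum of the matrix power P^m is strictly less than 1. Then every complex eigenvalue λ of P (i.e., every element of the spectrum of the complex matrix obtained by mapping the entries of P into ℂ) satisfies |λ| < 1; in particular the matrix I − P is invertible. -/
attribute [local instance] Matrix.linftyOpNormedRing Matrix.linftyOpNormedAlgebra in
theorem aux_spec {n 𝕜 : Type*} [Fintype n] [Nonempty n] [DecidableEq n] [RCLike 𝕜]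
    (P : Matrix n n ℝ)
    (hnonneg : ∀ i j, 0 ≤ P i j) (m : ℕ)
    (hrowm : ∀ i, ∑ j, (P ^ m) i j < 1) (μ : 𝕜)
    (hμ : μ ∈ spectrum 𝕜 (P.map (algebraMap ℝ 𝕜))) : ‖μ‖ < 1 := by
  have hpos : ∀ k : ℕ, ∀ i j, 0 ≤ (P ^ k) i j := by
    intro k
    induction k with
    | zero => intro i j; rw [pow_zero, Matrix.one_apply]; split_ifs <;> norm_num
    | succ k ih =>
      intro i j
      rw [pow_succ, Matrix.mul_apply]
      exact Finset.sum_nonneg fun l _ => mul_nonneg (ih i l) (hnonneg l j)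
  have h1 := spectrum.pow_mem_pow _ m hμ
  have h2 : (P.map (algebraMap ℝ 𝕜)) ^ m = (P ^ m).map (algebraMap ℝ 𝕜) :=
    (Matrix.map_pow P (algebraMap ℝ 𝕜) m).symm
  rw [h2] at h1
  have : CompleteSpace (Matrix n n 𝕜) := FiniteDimensional.complete 𝕜 _
  have : NormOneClass (Matrix n n 𝕜) := Matrix.linfty_opNormOneClass
  have h3 := spectrum.norm_le_norm_of_mem h1
  have h4 : ‖(P ^ m).map (algebraMap ℝ 𝕜)‖ < 1 := by
    rw [Matrix.linfty_opNorm_def]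
    rw [← NNReal.coe_one, NNReal.coe_lt_coe, Finset.sup_lt_iff (by simp)]
    intro i _
    rw [← NNReal.coe_lt_coe]
    push_cast
    convert hrowm i using 2 with j
    simp [abs_of_nonneg (hpos m i _)]
  rw [norm_pow] at h3
  by_contra hc
  have := one_le_pow₀ (n := m) (not_lt.mp hc)
  linarith

/-- If `P` is a real substochastic matrix (nonnegative entries, row sums ≤ 1)
and for some positive integer `m` every row sum of `P ^ m` is strictly less than `1`,
then every complex eigenvalue of `P` has modulus strictly less than `1`; in particular
`I - P` is invertible. -/
theorem stmt_0 {n : Type*} [Fintype n] [Nonempty n] [DecidableEq n]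
    (P : Matrix n n ℝ)
    (hnonneg : ∀ i j, 0 ≤ P i j)
    (hrow : ∀ i, ∑ j, P i j ≤ 1)
    (m : ℕ) (hm : 0 < m)
    (hrowm : ∀ i, ∑ j, (P ^ m) i j < 1) :
    (∀ μ ∈ spectrum ℂ (P.map (algebraMap ℝ ℂ)), ‖μ‖ < 1) ∧ IsUnit (1 - P) := by
  refine ⟨fun μ hμ => aux_spec P hnonneg m hrowm μ hμ, ?_⟩
  by_contra h
  have h1 : (1 : ℝ) ∈ spectrum ℝ (P.map (algebraMap ℝ ℝ)) := by
    rw [spectrum.mem_iff, map_one]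
    exact h
  have := aux_spec P hnonneg m hrowm (1 : ℝ) h1
  simp at this
end

section
/- Let n be a finite nonempty index set, P an n×n real matrix all of whose complex eigenvalues have modulus strictly less than 1, and R : n → ℝ a vector. Then I − P is invertible, V* := (I − P)^{-1} R is the unique solution of the linear system V = R + P·V, and every differentiable function V : ℝ → (n → ℝ) satisfying the ordinary differential equation V'(t) = R + P·V(t) − V(t) for all t ≥ 0 converges to V* as t → ∞; i.e., V* is the unique globally asymptotically stable equilibrium of the ODE dV/dt = R + P V − V. -/
open Filter Topology in
theorem aux_ode {E : Type*} [NormedAddCommGroup E] [NormedSpace ℝ E] [CompleteSpace E]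
    (L : E →L[ℝ] E) (C r : ℝ) (hr : r < 1)
    (hL : ∀ k : ℕ, ‖L ^ k‖ ≤ C * r ^ k) (W : ℝ → E)
    (hW : ∀ t : ℝ, 0 ≤ t → HasDerivAt W (L (W t) - W t) t) :
    Tendsto W atTop (𝓝 0) := by
  have hexp : ∀ t : ℝ, 0 ≤ t → ‖NormedSpace.exp (t • L)‖ ≤ C * Real.exp (t * r) := by
    intro t ht
    have h1 : HasSum (fun k : ℕ => C * ((k.factorial : ℝ)⁻¹ • (t * r) ^ k)) (C * Real.exp (t * r)) := by
      rw [Real.exp_eq_exp_ℝ]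
      exact (NormedSpace.exp_series_hasSum_exp' (𝕂 := ℝ) (t * r)).mul_left C
    have h2 := NormedSpace.exp_series_hasSum_exp' (𝕂 := ℝ) (t • L)
    rw [← h2.tsum_eq]
    refine tsum_of_norm_bounded h1 fun k => ?_
    rw [norm_smul, smul_pow, norm_smul, Real.norm_of_nonneg (by positivity),
      Real.norm_of_nonneg (by positivity), smul_eq_mul, mul_pow]
    calc _ ≤ (k.factorial : ℝ)⁻¹ * (t ^ k * (C * r ^ k)) := by
            gcongr; exact hL k
      _ = _ := by ring
  -- constant quantity
  have hG : ∀ t : ℝ, 0 ≤ t →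
      HasDerivAt (fun s : ℝ => Real.exp s • (NormedSpace.exp (s • (-L))) (W s)) 0 t := by
    intro t ht
    have h1 := (hasDerivAt_exp_smul_const (𝕂 := ℝ) (-L) t).clm_apply (hW t ht)
    have h2 := (Real.hasDerivAt_exp t).smul h1
    have h3 : Real.exp t • ((NormedSpace.exp (t • -L) * -L) (W t) +
        (NormedSpace.exp (t • -L)) (L (W t) - W t)) +
        Real.exp t • (NormedSpace.exp (t • -L)) (W t) = 0 := by
      rw [mul_apply_eq_comp, neg_apply, map_neg, map_sub]
      module
    rw [h3] at h2
    exact h2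
  have hconst : ∀ t : ℝ, 0 ≤ t →
      Real.exp t • (NormedSpace.exp (t • (-L))) (W t) = W 0 := by
    intro t ht
    have := constant_of_has_deriv_right_zero (a := 0) (b := t)
      (f := fun s : ℝ => Real.exp s • (NormedSpace.exp (s • (-L))) (W s))
      (fun s hs => (hG s hs.1).continuousAt.continuousWithinAt)
      (fun s hs => (hG s hs.1).hasDerivWithinAt) t ⟨ht, le_rfl⟩
    simpa using this
  have hWt : ∀ t : ℝ, 0 ≤ t → W t = Real.exp (-t) • NormedSpace.exp (t • L) (W 0) := by
    intro t ht
    rw [← hconst t ht, map_smul, smul_smul, ← Real.exp_add, neg_add_cancel, Real.exp_zero, one_smul,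
      ← mul_apply_eq_comp]
    have hc : Commute (t • L) (t • (-L)) := by
      rw [smul_neg]; exact (Commute.refl _).neg_right
    letI : NormedAlgebra ℚ (E →L[ℝ] E) := NormedAlgebra.restrictScalars ℚ ℝ _
    rw [← NormedSpace.exp_add_of_commute hc]
    simp
  have hlim : Tendsto (fun t : ℝ => C * Real.exp (-((1 - r) * t)) * ‖W 0‖) atTop (𝓝 0) := by
    have : Tendsto (fun t : ℝ => Real.exp (-((1 - r) * t))) atTop (𝓝 0) :=
      Real.tendsto_exp_neg_atTop_nhds_zero.comp (tendsto_id.const_mul_atTop (by linarith))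
    simpa using (this.const_mul C).mul_const ‖W 0‖
  refine squeeze_zero_norm' ?_ hlim
  filter_upwards [eventually_ge_atTop 0] with t ht
  rw [hWt t ht, norm_smul, Real.norm_of_nonneg (Real.exp_pos _).le]
  calc _ ≤ Real.exp (-t) * (C * Real.exp (t * r) * ‖W 0‖) := by
        gcongr
        exact (ContinuousLinearMap.le_opNorm _ _).trans (by gcongr; exact hexp t ht)
    _ = C * (Real.exp (-t) * Real.exp (t * r)) * ‖W 0‖ := by ring
    _ = _ := by rw [← Real.exp_add]; ring_nf

open Filter Topology in
theorem aux_gelfand {A : Type*} [NormedRing A] [NormedAlgebra ℂ A] [CompleteSpace A]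
    (a : A) (h : ∀ μ ∈ spectrum ℂ a, ‖μ‖ < 1) :
    ∃ C r : ℝ, r < 1 ∧ ∀ k : ℕ, ‖a ^ k‖ ≤ C * r ^ k := by
  have hρ : spectralRadius ℂ a < 1 := by
    rcases (spectrum ℂ a).eq_empty_or_nonempty with he | hne
    · simp [spectralRadius, he]
    · exact spectrum.spectralRadius_lt_of_forall_lt_of_nonempty hne
        (r := 1) (fun μ hμ => by simpa [← NNReal.coe_lt_coe] using h μ hμ)
  obtain ⟨r, hr1, hr2⟩ := ENNReal.lt_iff_exists_nnreal_btwn.1 hρ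
  have hr0 : 0 < r := by
    have := lt_of_le_of_lt (zero_le) hr1
    exact_mod_cast this
  have hev := (spectrum.pow_nnnorm_pow_one_div_tendsto_nhds_spectralRadius a).eventually_lt_const hr1
  obtain ⟨N, hN⟩ := eventually_atTop.1 hev
  have hr0' : (0 : ℝ) < r := by exact_mod_cast hr0
  refine ⟨1 + ∑ k ∈ Finset.range (N + 1), ‖a ^ k‖ / r ^ k, r, by exact_mod_cast hr2, fun k => ?_⟩
  rw [← div_le_iff₀ (by positivity)]
  have hs : 0 ≤ ∑ k ∈ Finset.range (N + 1), ‖a ^ k‖ / (r : ℝ) ^ k :=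
    Finset.sum_nonneg fun _ _ => by positivity
  by_cases hk : k < N + 1
  · have := Finset.single_le_sum (f := fun k => ‖a ^ k‖ / (r : ℝ) ^ k)
      (fun _ _ => by positivity) (Finset.mem_range.2 hk)
    linarith
  · have hk0 : (0 : ℝ) < k := by
      have : 0 < k := by omega
      exact_mod_cast this
    have h1 := hN k (by omega)
    rw [one_div, ENNReal.rpow_inv_lt_iff hk0, ENNReal.rpow_natCast] at h1
    have h2 : ‖a ^ k‖₊ < r ^ k := by exact_mod_cast h1
    have h3 : ‖a ^ k‖ < (r : ℝ) ^ k := by exact_mod_cast h2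
    have : ‖a ^ k‖ / (r : ℝ) ^ k ≤ 1 := (div_le_one (by positivity)).2 h3.le
    linarith

attribute [local instance] Matrix.linftyOpNormedRing Matrix.linftyOpNormedAlgebra in
theorem aux_mat {n : Type*} [Fintype n] [Nonempty n] [DecidableEq n]
    (P : Matrix n n ℝ)
    (hspec : ∀ μ ∈ spectrum ℂ (P.map (algebraMap ℝ ℂ)), ‖μ‖ < 1) :
    ∃ C r : ℝ, r < 1 ∧ ∀ k : ℕ, ‖(LinearMap.toContinuousLinearMap (Matrix.toLin' P)) ^ k‖ ≤ C * r ^ k := by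
  haveI : CompleteSpace (Matrix n n ℂ) := FiniteDimensional.complete ℂ _
  obtain ⟨C, r, hr, h⟩ := aux_gelfand (P.map (algebraMap ℝ ℂ)) hspec
  refine ⟨C, r, hr, fun k => le_trans ?_ (h k)⟩
  have hp : (P.map (algebraMap ℝ ℂ)) ^ k = (P ^ k).map (algebraMap ℝ ℂ) :=
    (map_pow (algebraMap ℝ ℂ).mapMatrix P k).symm
  have hn : ‖(P ^ k).map (algebraMap ℝ ℂ)‖ = ‖P ^ k‖ := by
    simp [Matrix.linfty_opNorm_def]
  rw [hp, hn]
  refine ContinuousLinearMap.opNorm_le_bound _ (norm_nonneg _) fun x => ?_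
  have : ∀ (j : ℕ) (y : n → ℝ),
      ((LinearMap.toContinuousLinearMap (Matrix.toLin' P)) ^ j) y = (P ^ j).mulVec y := by
    intro j
    induction j with
    | zero => simp
    | succ j ih =>
      intro y
      rw [pow_succ, pow_succ, mul_apply_eq_comp, ih, ← Matrix.mulVec_mulVec]
      simp
  rw [this]
  exact Matrix.linfty_opNorm_mulVec _ _

/-- If all complex eigenvalues of the real matrix `P` have modulus `< 1`,
then `I - P` is invertible, `V* = (I - P)⁻¹ R` is the unique solution of `V = R + P V`,
and every differentiable solution of the ODE `V' = R + P V - V` (for `t ≥ 0`) converges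
to `V*` as `t → ∞`. -/
theorem stmt_1 {n : Type*} [Fintype n] [Nonempty n] [DecidableEq n]
    (P : Matrix n n ℝ) (R : n → ℝ)
    (hspec : ∀ μ ∈ spectrum ℂ (P.map (algebraMap ℝ ℂ)), ‖μ‖ < 1) :
    IsUnit (1 - P) ∧
    (∀ V : n → ℝ, (V = R + P.mulVec V ↔ V = (1 - P)⁻¹.mulVec R)) ∧
    (∀ V : ℝ → (n → ℝ), Differentiable ℝ V →
      (∀ t : ℝ, 0 ≤ t → deriv V t = R + P.mulVec (V t) - V t) →
      Filter.Tendsto V Filter.atTop (nhds ((1 - P)⁻¹.mulVec R))) := by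
  have hU : IsUnit (1 - P) := by
    have h1 : (1 : ℂ) ∉ spectrum ℂ (P.map (algebraMap ℝ ℂ)) := fun h => by
      simpa using hspec 1 h
    rw [spectrum.notMem_iff, map_one] at h1
    have h2 : (1 : Matrix n n ℂ) - P.map (algebraMap ℝ ℂ) = (algebraMap ℝ ℂ).mapMatrix (1 - P) := by
      rw [map_sub, map_one]; rfl
    rw [h2, Matrix.isUnit_iff_isUnit_det, ← RingHom.map_det, isUnit_iff_ne_zero] at h1
    rw [Matrix.isUnit_iff_isUnit_det, isUnit_iff_ne_zero]
    exact fun h => h1 (by rw [h, map_zero])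
  have hdet := (Matrix.isUnit_iff_isUnit_det _).1 hU
  have hiff : ∀ V : n → ℝ, (V = R + P.mulVec V ↔ V = (1 - P)⁻¹.mulVec R) := by
    intro V
    constructor
    · intro h
      have h1 : (1 - P).mulVec V = R := by
        rw [Matrix.sub_mulVec, Matrix.one_mulVec, sub_eq_iff_eq_add]; exact h
      rw [← h1, Matrix.mulVec_mulVec, Matrix.nonsing_inv_mul _ hdet, Matrix.one_mulVec]
    · intro h
      have h1 : (1 - P).mulVec V = R := by
        rw [h, Matrix.mulVec_mulVec, Matrix.mul_nonsing_inv _ hdet, Matrix.one_mulVec]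
      rwa [Matrix.sub_mulVec, Matrix.one_mulVec, sub_eq_iff_eq_add] at h1
  refine ⟨hU, hiff, fun V hV hode => ?_⟩
  obtain ⟨C, r, hr, h⟩ := aux_mat P hspec
  have hs := (hiff _).2 rfl
  set S := (1 - P)⁻¹.mulVec R
  have := aux_ode _ C r hr h (fun t => V t - S) (fun t ht => by
    have h1 := (hV t).hasDerivAt.sub_const S
    rw [hode t ht] at h1
    convert h1 using 1
    simp only [LinearMap.coe_toContinuousLinearMap', Matrix.toLin'_apply, Matrix.mulVec_sub]
    nth_rewrite 2 [hs]
    abel)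
  simpa using this.add_const S
end

section
/- Under Assumption 1, for every θ0 > 0 there exists a constant K ≥ 0 such that the map θ ↦ V^θ := (I − P_{π_θ})^{-1} R_{π_θ} is K-Lipschitz continuous on the compact box {θ : S⁻ × A → ℝ : |θ(i,u)| ≤ θ0 for all i,u} (with respect to the sup norms on the domain and codomain). -/
/-- The state-transition matrix `P_π` of a stationary randomized policy `π`. -/
noncomputable def Pmat {S A : Type*} [Fintype S] [Fintype A]
    (p : S → A → S → ℝ) (π : S → A → ℝ) : Matrix S S ℝ :=
  Matrix.of fun i j => ∑ u, π i u * p i u j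

/-- The expected one-stage cost vector `R_π` of a stationary randomized policy `π`. -/
noncomputable def Rvec {S A : Type*} [Fintype A]
    (g : S → A → ℝ) (π : S → A → ℝ) : S → ℝ :=
  fun i => ∑ u, π i u * g i u

/-- The softmax policy parameterized by `θ`. -/
noncomputable def softmax {S A : Type*} [Fintype A] (θ : S × A → ℝ) : S → A → ℝ :=
  fun i u => Real.exp (θ (i, u)) / ∑ u', Real.exp (θ (i, u'))

/-- The value function `V^θ = (I - P_{π_θ})⁻¹ R_{π_θ}` of the softmax policy `π_θ`. -/
noncomputable def Vval {S A : Type*} [Fintype S] [Fintype A] [DecidableEq S]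
    (p : S → A → S → ℝ) (g : S → A → ℝ) (θ : S × A → ℝ) : S → ℝ :=
  ((1 - Pmat p (softmax θ))⁻¹).mulVec (Rvec g (softmax θ))

theorem detDiff {E S : Type*} [NormedAddCommGroup E] [NormedSpace ℝ E] [Fintype S] [DecidableEq S]
    (M : E → Matrix S S ℝ) (hM : ∀ i j, ContDiff ℝ 1 fun θ => M θ i j) :
    ContDiff ℝ 1 fun θ => (M θ).det := by
  simp only [Matrix.det_apply]
  refine ContDiff.sum fun σ _ => ContDiff.const_smul _ (contDiff_prod fun i _ => hM _ _)

theorem adjDiff {E S : Type*} [NormedAddCommGroup E] [NormedSpace ℝ E] [Fintype S] [DecidableEq S]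
    (M : E → Matrix S S ℝ) (hM : ∀ i j, ContDiff ℝ 1 fun θ => M θ i j) (i j : S) :
    ContDiff ℝ 1 fun θ => (M θ).adjugate i j := by
  simp only [Matrix.adjugate_apply]
  refine detDiff _ fun k l => ?_
  simp only [Matrix.updateRow_apply]
  split_ifs
  · exact contDiff_const
  · exact hM k l

theorem softmax_den_pos {S A : Type*} [Fintype A] [Nonempty A] (θ : S × A → ℝ) (i : S) :
    0 < ∑ u', Real.exp (θ (i, u')) :=
  Finset.sum_pos (fun _ _ => Real.exp_pos _) Finset.univ_nonempty

theorem softmaxDiff {S A : Type*} [Fintype S] [Fintype A] [Nonempty A] (i : S) (u : A) :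
    ContDiff ℝ 1 fun θ : S × A → ℝ => softmax θ i u := by
  unfold softmax
  refine ContDiff.div (by fun_prop) (by fun_prop) fun θ => (softmax_den_pos θ i).ne'

/-- Under Assumption 1 (every stationary randomized policy is proper, i.e. the
spectral radius of `P_π` is `< 1`), for every `θ0 > 0` the map `θ ↦ V^θ` is Lipschitz
continuous on the box `{θ : |θ(i,u)| ≤ θ0}` (sup norms on domain and codomain). -/
theorem stmt_2 {S A : Type*} [Fintype S] [Fintype A] [Nonempty S] [Nonempty A] [DecidableEq S]
    (p : S → A → S → ℝ)
    (hp : ∀ i u j, 0 ≤ p i u j) (hps : ∀ i u, ∑ j, p i u j ≤ 1)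
    (g : S → A → ℝ) (B : ℝ) (hB : 0 ≤ B) (hg : ∀ i u, |g i u| ≤ B)
    (hproper : ∀ π : S → A → ℝ, (∀ i u, 0 ≤ π i u) → (∀ i, ∑ u, π i u = 1) →
      ∀ μ ∈ spectrum ℂ ((Pmat p π).map (algebraMap ℝ ℂ)), ‖μ‖ < 1)
    (θ0 : ℝ) (hθ0 : 0 < θ0) :
    ∃ K : ℝ, 0 ≤ K ∧ ∀ θ₁ θ₂ : S × A → ℝ,
      (∀ i u, |θ₁ (i, u)| ≤ θ0) → (∀ i u, |θ₂ (i, u)| ≤ θ0) →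
      ‖Vval p g θ₁ - Vval p g θ₂‖ ≤ K * ‖θ₁ - θ₂‖ := by
  have hdet : ∀ θ : S × A → ℝ, (1 - Pmat p (softmax θ)).det ≠ 0 := by
    intro θ h0
    have h1 := hproper (softmax θ)
      (fun i u => div_nonneg (Real.exp_pos _).le (softmax_den_pos θ i).le)
      (fun i => by
        simp only [softmax]
        rw [← Finset.sum_div, div_self (softmax_den_pos θ i).ne'])
      1 ?_
    · simp at h1
    · rw [spectrum.mem_iff, map_one]
      have e : (1 : Matrix S S ℂ) - (Pmat p (softmax θ)).map (algebraMap ℝ ℂ)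
          = (algebraMap ℝ ℂ).mapMatrix (1 - Pmat p (softmax θ)) := by
        rw [map_sub, map_one]; rfl
      rw [e, Matrix.isUnit_iff_isUnit_det, ← RingHom.map_det, h0]
      simp
  have hM : ∀ i j, ContDiff ℝ 1 fun θ : S × A → ℝ => (1 - Pmat p (softmax θ)) i j := by
    intro i j
    simp only [Matrix.sub_apply, Pmat, Matrix.of_apply]
    exact contDiff_const.sub
      (ContDiff.sum fun u _ => (softmaxDiff i u).mul contDiff_const)
  have hV : ContDiff ℝ 1 (Vval p g) := by
    rw [contDiff_pi]
    intro i
    have e : (fun θ => Vval p g θ i) = fun θ => ∑ j, ((1 - Pmat p (softmax θ)).det)⁻¹ *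
        (1 - Pmat p (softmax θ)).adjugate i j * ∑ u, softmax θ j u * g j u := by
      funext θ
      simp [Vval, Rvec, Matrix.mulVec, dotProduct, Matrix.inv_def]
    rw [e]
    refine ContDiff.sum fun j _ => ContDiff.mul (ContDiff.mul ?_ (adjDiff _ hM i j)) ?_
    · exact (detDiff _ hM).inv hdet
    · exact ContDiff.sum fun u _ => (softmaxDiff j u).mul contDiff_const
  obtain ⟨K, hK⟩ := (hV.contDiffOn (s := Metric.closedBall 0 θ0)).exists_lipschitzOnWith
    one_ne_zero (convex_closedBall _ _) (isCompact_closedBall _ _)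
  refine ⟨K, K.2, fun θ₁ θ₂ h₁ h₂ => ?_⟩
  have hm : ∀ θ : S × A → ℝ, (∀ i u, |θ (i, u)| ≤ θ0) → θ ∈ Metric.closedBall 0 θ0 := by
    intro θ h
    rw [mem_closedBall_zero_iff, pi_norm_le_iff_of_nonneg hθ0.le]
    exact fun x => h x.1 x.2
  have := hK.dist_le_mul _ (hm _ h₁) _ (hm _ h₂)
  rwa [dist_eq_norm, dist_eq_norm] at this
end

section
/- Under Assumption 1, for every θ : S⁻ × A → ℝ and every function γ : S⁻ × A → [0,1], with V^θ := (I − P_{π_θ})^{-1} R_{π_θ}, the following descent inequality holds: ∑_{(s,u)∈S⁻×A} (∑_{i∈S⁻} ((I − P_{π_θ})^{-1})_{i,s}) · π_θ(s,u) · k_{su}(V^θ) · (− k_{su}(V^θ) · γ(s,u)) ≤ 0. In other words, the inner product of the gradient of θ ↦ ∑_{i∈S⁻} V^θ(i) with the projected negative temporal-difference direction is nonpositive. -/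
/-- The temporal-difference term `k_{iu}(V) = ḡ(i,u) + ∑_j p(i,u,j) V(j) − V(i)`. -/
noncomputable def kTD {S A : Type*} [Fintype S]
    (p : S → A → S → ℝ) (g : S → A → ℝ) (V : S → ℝ) (i : S) (u : A) : ℝ :=
  g i u + ∑ j, p i u j * V j - V i

open Filter Topology in
lemma aux_inv_nonneg {S : Type*} [Fintype S] [Nonempty S] [DecidableEq S]
    (P : Matrix S S ℝ) (h0 : ∀ i j, 0 ≤ P i j) (h1 : ∀ i, ∑ j, P i j ≤ 1)
    (hd : (1 - P).det ≠ 0) (i j : S) : 0 ≤ (1 - P)⁻¹ i j := by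
  have hcont : Continuous (fun t : ℝ => (1 - t • P)) := by fun_prop
  have hdc : Continuous (fun t : ℝ => (1 - t • P).det) := hcont.matrix_det
  have hac : Continuous (fun t : ℝ => (1 - t • P).adjugate i j) :=
    (hcont.matrix_adjugate).matrix_elem i j
  have hd1 : (1 - (1:ℝ) • P).det ≠ 0 := by simpa using hd
  have hlim : Tendsto (fun t : ℝ => (1 - t • P)⁻¹ i j) (𝓝[<] 1) (𝓝 ((1 - P)⁻¹ i j)) := by
    have : ContinuousAt (fun t : ℝ => (1 - t • P)⁻¹ i j) 1 := by
      simp only [Matrix.inv_def, Ring.inverse_eq_inv', Matrix.smul_apply, smul_eq_mul]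
      exact (hdc.continuousAt.inv₀ hd1).mul hac.continuousAt
    have h := this.tendsto.mono_left (nhdsWithin_le_nhds (s := Set.Iio 1))
    simpa using h
  refine ge_of_tendsto hlim ?_
  have e1 : ∀ᶠ t : ℝ in 𝓝[<] 1, (1 - t • P).det ≠ 0 :=
    (hdc.continuousAt.eventually_ne hd1).filter_mono nhdsWithin_le_nhds
  have e2 : ∀ᶠ t : ℝ in 𝓝[<] 1, 0 < t :=
    (lt_mem_nhds one_pos).filter_mono nhdsWithin_le_nhds
  filter_upwards [e1, e2, self_mem_nhdsWithin] with t ht htp ht1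
  have ht1 : t < 1 := ht1
  have hN : (1 - t • P) * (1 - t • P)⁻¹ = 1 := Matrix.mul_nonsing_inv _ (isUnit_iff_ne_zero.2 ht)
  generalize (1 - t • P)⁻¹ = N at hN
  obtain ⟨a, ha⟩ := Finite.exists_min (fun k => N k j)
  by_contra! hneg
  have hm : N a j < 0 := (ha i).trans_lt hneg
  have hE := congrFun (congrFun hN a) j
  rw [sub_mul, one_mul, Matrix.smul_mul] at hE
  simp only [Matrix.sub_apply, Matrix.smul_apply, smul_eq_mul, Matrix.mul_apply] at hE
  have hone : (0:ℝ) ≤ (1 : Matrix S S ℝ) a j := by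
    rw [Matrix.one_apply]; split_ifs <;> norm_num
  have hs : (∑ k, P a k) * N a j ≤ ∑ k, P a k * N k j := by
    rw [Finset.sum_mul]
    exact Finset.sum_le_sum fun k _ => mul_le_mul_of_nonneg_left (ha k) (h0 a k)
  have hs2 : N a j ≤ (∑ k, P a k) * N a j := by nlinarith [h1 a]
  nlinarith [mul_le_mul_of_nonneg_left (hs2.trans hs) htp.le]

/-- Under Assumption 1, the inner product of the gradient of
`θ ↦ ∑_i V^θ(i)` with the projected negative temporal-difference direction is nonpositive:
for every `θ` and every `γ : S⁻ × A → [0,1]`,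
`∑_{(s,u)} (∑_i ((I-P_{π_θ})⁻¹)_{i,s}) π_θ(s,u) k_{su}(V^θ) (−k_{su}(V^θ) γ(s,u)) ≤ 0`. -/
theorem stmt_4 {S A : Type*} [Fintype S] [Fintype A] [Nonempty S] [Nonempty A] [DecidableEq S]
    (p : S → A → S → ℝ)
    (hp : ∀ i u j, 0 ≤ p i u j) (hps : ∀ i u, ∑ j, p i u j ≤ 1)
    (g : S → A → ℝ) (B : ℝ) (hB : 0 ≤ B) (hg : ∀ i u, |g i u| ≤ B)
    (hproper : ∀ π : S → A → ℝ, (∀ i u, 0 ≤ π i u) → (∀ i, ∑ u, π i u = 1) →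
      ∀ μ ∈ spectrum ℂ ((Pmat p π).map (algebraMap ℝ ℂ)), ‖μ‖ < 1)
    (θ : S × A → ℝ) (γ : S × A → ℝ)
    (hγ0 : ∀ s u, 0 ≤ γ (s, u)) (hγ1 : ∀ s u, γ (s, u) ≤ 1) :
    ∑ s : S, ∑ u : A,
      (∑ i, (1 - Pmat p (softmax θ))⁻¹ i s) * softmax θ s u * kTD p g (Vval p g θ) s u *
        (-(kTD p g (Vval p g θ) s u) * γ (s, u)) ≤ 0 := by
  have hz : ∀ s, 0 < ∑ u', Real.exp (θ (s, u')) := fun s =>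
    Finset.sum_pos (fun u _ => Real.exp_pos _) Finset.univ_nonempty
  have hπ0 : ∀ s u, 0 ≤ softmax θ s u := fun s u => div_nonneg (Real.exp_pos _).le (hz s).le
  have hπ1 : ∀ s, ∑ u, softmax θ s u = 1 := fun s => by
    simp only [softmax]
    rw [← Finset.sum_div, div_self (hz s).ne']
  have hP0 : ∀ i j, 0 ≤ Pmat p (softmax θ) i j := fun i j =>
    Finset.sum_nonneg fun u _ => mul_nonneg (hπ0 i u) (hp i u j)
  have hP1 : ∀ i, ∑ j, Pmat p (softmax θ) i j ≤ 1 := fun i => by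
    simp only [Pmat, Matrix.of_apply]
    rw [Finset.sum_comm, ← hπ1 i]
    refine Finset.sum_le_sum fun u _ => ?_
    rw [← Finset.mul_sum]
    exact mul_le_of_le_one_right (hπ0 i u) (hps i u)
  have hd : (1 - Pmat p (softmax θ)).det ≠ 0 := by
    have hspec := hproper (softmax θ) hπ0 hπ1 1
    have hns : (1:ℂ) ∉ spectrum ℂ ((Pmat p (softmax θ)).map (algebraMap ℝ ℂ)) := by
      intro h
      simpa using hspec h
    rw [spectrum.notMem_iff, map_one, Matrix.isUnit_iff_isUnit_det, isUnit_iff_ne_zero] at hns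
    intro h
    apply hns
    have h2 := (algebraMap ℝ ℂ).map_det (1 - Pmat p (softmax θ))
    rw [h, map_zero, map_sub, map_one] at h2
    exact h2.symm
  refine Finset.sum_nonpos fun s _ => Finset.sum_nonpos fun u _ => ?_
  have hN : 0 ≤ ∑ i, (1 - Pmat p (softmax θ))⁻¹ i s :=
    Finset.sum_nonneg fun i _ => aux_inv_nonneg _ hP0 hP1 hd i s
  have := mul_nonneg (mul_nonneg (mul_nonneg hN (hπ0 s u))
    (mul_self_nonneg (kTD p g (Vval p g θ) s u))) (hγ0 s u)
  linarith
end

section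
/- Let ξ be a weight vector, let π be a stationary randomized policy, and let V : S⁻ → ℝ satisfy the policy Bellman equation V = T_π V. Then |V(i)| ≤ B · ξ(i) for every i ∈ S⁻; in particular max_{i∈S⁻} |V(i)| ≤ B · max_{i∈S⁻} ξ(i). -/
/-- The Bellman operator `T_π` of a stationary randomized policy `π`:
`(T_π V)(i) = ∑_u π(i,u) (ḡ(i,u) + ∑_j p(i,u,j) V(j))`. -/
noncomputable def Tpol {S A : Type*} [Fintype S] [Fintype A]
    (p : S → A → S → ℝ) (g : S → A → ℝ) (π : S → A → ℝ) (V : S → ℝ) : S → ℝ :=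
  fun i => ∑ u, π i u * (g i u + ∑ j, p i u j * V j)

/-- The optimal Bellman operator `T`:
`(T V)(i) = min_u (ḡ(i,u) + ∑_j p(i,u,j) V(j))`. -/
noncomputable def Topt {S A : Type*} [Fintype S] [Fintype A] [Nonempty A]
    (p : S → A → S → ℝ) (g : S → A → ℝ) (V : S → ℝ) : S → ℝ :=
  fun i => Finset.univ.inf' Finset.univ_nonempty (fun u => g i u + ∑ j, p i u j * V j)

/-- The weighted sup-norm `‖V‖_ξ = max_i |V(i)|/ξ(i)`. -/
noncomputable def wnorm {S : Type*} [Fintype S] [Nonempty S] (ξ : S → ℝ) (V : S → ℝ) : ℝ :=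
  Finset.univ.sup' Finset.univ_nonempty (fun i => |V i| / ξ i)

/-- The contraction modulus `β = max_i (ξ(i)−1)/ξ(i)` of a weight vector `ξ`. -/
noncomputable def betaXi {S : Type*} [Fintype S] [Nonempty S] (ξ : S → ℝ) : ℝ :=
  Finset.univ.sup' Finset.univ_nonempty (fun i => (ξ i - 1) / ξ i)

/-- If `ξ` is a weight vector, `π` is a stationary randomized policy, and
`V = T_π V`, then `|V(i)| ≤ B ξ(i)` for every `i`; in particular
`max_i |V(i)| ≤ B max_i ξ(i)`. -/
theorem stmt_9 {S A : Type*} [Fintype S] [Fintype A] [Nonempty S] [Nonempty A]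
    (p : S → A → S → ℝ)
    (hp : ∀ i u j, 0 ≤ p i u j) (hps : ∀ i u, ∑ j, p i u j ≤ 1)
    (g : S → A → ℝ) (B : ℝ) (hB : 0 ≤ B) (hg : ∀ i u, |g i u| ≤ B)
    (ξ : S → ℝ) (hξ1 : ∀ i, 1 ≤ ξ i)
    (hξ : ∀ i u, 1 + ∑ j, p i u j * ξ j ≤ ξ i)
    (π : S → A → ℝ) (hπ0 : ∀ i u, 0 ≤ π i u) (hπ1 : ∀ i, ∑ u, π i u = 1)
    (V : S → ℝ) (hV : V = Tpol p g π V) :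
    (∀ i, |V i| ≤ B * ξ i) ∧
    Finset.univ.sup' Finset.univ_nonempty (fun i => |V i|) ≤
      B * Finset.univ.sup' Finset.univ_nonempty (fun i => ξ i) := by
  have key : ∀ i, |V i| ≤ B * ξ i := by
    obtain ⟨i, -, hi⟩ := Finset.exists_max_image Finset.univ (fun i => |V i| / ξ i)
      Finset.univ_nonempty
    have hpos : ∀ j, 0 < ξ j := fun j => lt_of_lt_of_le one_pos (hξ1 j)
    set c := |V i| / ξ i with hc
    have hc0 : 0 ≤ c := div_nonneg (abs_nonneg _) (hpos i).le
    have hj : ∀ j, |V j| ≤ c * ξ j := fun j =>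
      (div_le_iff₀ (hpos j)).1 (hi j (Finset.mem_univ j))
    have hci : |V i| = c * ξ i := by
      rw [hc, div_mul_cancel₀ _ (hpos i).ne']
    have hu : ∀ u, |g i u + ∑ j, p i u j * V j| ≤ B + c * (ξ i - 1) := by
      intro u
      have h1 : |∑ j, p i u j * V j| ≤ c * ∑ j, p i u j * ξ j := by
        rw [Finset.mul_sum]
        refine (Finset.abs_sum_le_sum_abs _ _).trans (Finset.sum_le_sum fun j _ => ?_)
        rw [abs_mul, abs_of_nonneg (hp i u j)]
        have := mul_le_mul_of_nonneg_left (hj j) (hp i u j)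
        linarith
      have h2 : c * ∑ j, p i u j * ξ j ≤ c * (ξ i - 1) :=
        mul_le_mul_of_nonneg_left (by linarith [hξ i u]) hc0
      have h3 := abs_add_le (g i u) (∑ j, p i u j * V j)
      linarith [hg i u]
    have hVi : |V i| ≤ B + c * (ξ i - 1) := by
      have h0 : V i = ∑ u, π i u * (g i u + ∑ j, p i u j * V j) := congrFun hV i
      rw [h0]
      calc |∑ u, π i u * (g i u + ∑ j, p i u j * V j)|
          ≤ ∑ u, π i u * (B + c * (ξ i - 1)) := by
            refine (Finset.abs_sum_le_sum_abs _ _).trans (Finset.sum_le_sum fun u _ => ?_)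
            rw [abs_mul, abs_of_nonneg (hπ0 i u)]
            exact mul_le_mul_of_nonneg_left (hu u) (hπ0 i u)
        _ = B + c * (ξ i - 1) := by rw [← Finset.sum_mul, hπ1, one_mul]
    have hcB : c ≤ B := by linarith
    exact fun j => (hj j).trans (mul_le_mul_of_nonneg_right hcB (hpos j).le)
  refine ⟨key, Finset.sup'_le _ _ fun i _ => (key i).trans ?_⟩
  exact mul_le_mul_of_nonneg_left
    (Finset.le_sup' (fun i => ξ i) (Finset.mem_univ i)) hB
end

section
/- Let ξ be a weight vector with ξ_max = max_{i∈S⁻} ξ(i), ξ_min = min_{i∈S⁻} ξ(i), and β = max_{i∈S⁻} (ξ(i)−1)/ξ(i). Let θ0 > 0 and let θ̂ : S⁻ × A → ℝ with |θ̂(i,u)| ≤ θ0 for all (i,u). Let V̂ : S⁻ → ℝ satisfy the policy Bellman equation V̂ = T_{π_{θ̂}} V̂ for the softmax policy π_{θ̂}, and suppose θ̂ is an equilibrium of the actor dynamics, i.e., for all (i,u): θ̂(i,u) = θ0 whenever k_{iu}(V̂) < 0 and θ̂(i,u) = −θ0 whenever k_{iu}(V̂) > 0. Let V* : S⁻ →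 ℝ satisfy T V* = V*. Then for every i ∈ S⁻, |V̂(i) − V*(i)| ≤ (ξ_max · B · (1 + 2ξ_max) · |A|) / (ξ_min · exp(2θ0) · (1 − β)), where |A| is the cardinality of A. -/
/-- `ξ_max = max_i ξ(i)`. -/
noncomputable def xiMax {S : Type*} [Fintype S] [Nonempty S] (ξ : S → ℝ) : ℝ :=
  Finset.univ.sup' Finset.univ_nonempty ξ

/-- `ξ_min = min_i ξ(i)`. -/
noncomputable def xiMin {S : Type*} [Fintype S] [Nonempty S] (ξ : S → ℝ) : ℝ :=
  Finset.univ.inf' Finset.univ_nonempty ξ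

theorem aux_le {S A : Type*} [Fintype S] [Nonempty S]
    (p : S → A → S → ℝ) (hp : ∀ i u j, 0 ≤ p i u j)
    (ξ : S → ℝ) (hξ1 : ∀ i, 1 ≤ ξ i)
    (hξ : ∀ i u, 1 + ∑ j, p i u j * ξ j ≤ ξ i)
    (ε : ℝ) (hε : 0 ≤ ε) (D : S → ℝ)
    (hD : ∀ i, ∃ u, D i ≤ ε + ∑ j, p i u j * D j) : ∀ i, D i ≤ ε * ξ i := by
  have hpos : ∀ i, 0 < ξ i := fun i => lt_of_lt_of_le one_pos (hξ1 i)
  obtain ⟨i0, h0⟩ := Finite.exists_max (fun i => D i / ξ i)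
  obtain ⟨M, hM⟩ : ∃ M, M = D i0 / ξ i0 := ⟨_, rfl⟩
  have hDM : ∀ j, D j ≤ M * ξ j := by
    intro j
    rw [hM]
    exact (div_le_iff₀ (hpos j)).1 (h0 j)
  have hM0 : D i0 = M * ξ i0 := by
    rw [hM, div_mul_cancel₀ _ (hpos i0).ne']
  have hMε : M ≤ ε := by
    rcases le_total M 0 with h | h
    · linarith
    · obtain ⟨u, hu⟩ := hD i0
      have h1 : ∑ j, p i0 u j * D j ≤ M * ∑ j, p i0 u j * ξ j := by
        rw [Finset.mul_sum]
        refine Finset.sum_le_sum fun j _ => ?_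
        nlinarith [mul_le_mul_of_nonneg_left (hDM j) (hp i0 u j)]
      nlinarith [mul_le_mul_of_nonneg_left (hξ i0 u) h]
  intro i
  exact (hDM i).trans (mul_le_mul_of_nonneg_right hMε (hpos i).le)

/-- Explicit suboptimality bound for a stable actor equilibrium `(θ̂, V̂)`:
`|V̂(i) − V*(i)| ≤ ξ_max B (1 + 2 ξ_max) |A| / (ξ_min exp(2θ0) (1 − β))` for every `i`. -/
theorem stmt_10 {S A : Type*} [Fintype S] [Fintype A] [Nonempty S] [Nonempty A]
    (p : S → A → S → ℝ)
    (hp : ∀ i u j, 0 ≤ p i u j) (hps : ∀ i u, ∑ j, p i u j ≤ 1)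
    (g : S → A → ℝ) (B : ℝ) (hB : 0 ≤ B) (hg : ∀ i u, |g i u| ≤ B)
    (ξ : S → ℝ) (hξ1 : ∀ i, 1 ≤ ξ i)
    (hξ : ∀ i u, 1 + ∑ j, p i u j * ξ j ≤ ξ i)
    (θ0 : ℝ) (hθ0 : 0 < θ0)
    (θhat : S × A → ℝ) (hθhat : ∀ i u, |θhat (i, u)| ≤ θ0)
    (Vhat : S → ℝ) (hVhat : Vhat = Tpol p g (softmax θhat) Vhat)
    (heq1 : ∀ i u, kTD p g Vhat i u < 0 → θhat (i, u) = θ0)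
    (heq2 : ∀ i u, 0 < kTD p g Vhat i u → θhat (i, u) = -θ0)
    (Vstar : S → ℝ) (hVstar : Topt p g Vstar = Vstar) :
    ∀ i, |Vhat i - Vstar i| ≤
      xiMax ξ * B * (1 + 2 * xiMax ξ) * (Fintype.card A : ℝ) /
        (xiMin ξ * Real.exp (2 * θ0) * (1 - betaXi ξ)) := by
  have hsum : ∀ i, ∑ u, Real.exp (θhat (i, u)) * kTD p g Vhat i u = 0 := by
    intro i
    have hZ : 0 < ∑ u', Real.exp (θhat (i, u')) :=
      Finset.sum_pos (fun u _ => Real.exp_pos _) Finset.univ_nonempty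
    have h := congrFun hVhat i
    have h2 : (∑ u, Real.exp (θhat (i, u)) * (g i u + ∑ j, p i u j * Vhat j)) /
        (∑ u', Real.exp (θhat (i, u'))) = Vhat i := by
      refine Eq.trans ?_ h.symm
      simp only [Tpol, softmax]
      rw [Finset.sum_div]
      refine Finset.sum_congr rfl fun u _ => ?_
      rw [div_mul_eq_mul_div]
    rw [div_eq_iff hZ.ne'] at h2
    simp only [kTD, mul_sub, Finset.sum_sub_distrib]
    rw [h2, ← Finset.sum_mul]
    ring
  have hle : ∀ i, ∃ u, kTD p g Vhat i u ≤ 0 := by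
    intro i
    by_contra! hc
    have := Finset.sum_pos (fun u (_ : u ∈ Finset.univ) =>
      mul_pos (Real.exp_pos (θhat (i, u))) (hc u)) Finset.univ_nonempty
    linarith [hsum i]
  have hge : ∀ i, ∃ u, 0 ≤ kTD p g Vhat i u := by
    intro i
    by_contra! hc
    have := Finset.sum_neg (fun u (_ : u ∈ Finset.univ) =>
      mul_neg_of_pos_of_neg (Real.exp_pos (θhat (i, u))) (hc u)) Finset.univ_nonempty
    linarith [hsum i]
  have hV1 : ∀ i, Vhat i ≤ B * ξ i := by
    refine aux_le p hp ξ hξ1 hξ B hB Vhat fun i => ?_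
    obtain ⟨u, hu⟩ := hge i
    refine ⟨u, ?_⟩
    have := (abs_le.1 (hg i u)).2
    unfold kTD at hu
    linarith
  have hV2 : ∀ i, -Vhat i ≤ B * ξ i := by
    refine aux_le p hp ξ hξ1 hξ B hB (fun i => -Vhat i) fun i => ?_
    obtain ⟨u, hu⟩ := hle i
    refine ⟨u, ?_⟩
    have := (abs_le.1 (hg i u)).1
    unfold kTD at hu
    simp only [mul_neg, Finset.sum_neg_distrib]
    linarith
  have hmax : ∀ i, ξ i ≤ xiMax ξ := fun i => Finset.le_sup' ξ (Finset.mem_univ i)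
  have hmax1 : 1 ≤ xiMax ξ := (hξ1 (Classical.arbitrary S)).trans (hmax _)
  obtain ⟨C, hC⟩ : ∃ C, C = B * (1 + 2 * xiMax ξ) := ⟨_, rfl⟩
  have hC0 : 0 ≤ C := by rw [hC]; positivity
  have hk : ∀ i u, kTD p g Vhat i u ≤ C := by
    intro i u
    have h1 : ∑ j, p i u j * Vhat j ≤ B * ∑ j, p i u j * ξ j := by
      rw [Finset.mul_sum]
      refine Finset.sum_le_sum fun j _ => ?_
      nlinarith [mul_le_mul_of_nonneg_left (hV1 j) (hp i u j)]
    have h2 := mul_le_mul_of_nonneg_left (hξ i u) hB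
    have h3 := mul_le_mul_of_nonneg_left (hmax i) hB
    have h4 := hV2 i
    have h5 := (abs_le.1 (hg i u)).2
    unfold kTD
    rw [hC]
    nlinarith
  obtain ⟨ε, hε⟩ : ∃ ε, ε = C * (Fintype.card A : ℝ) / Real.exp (2 * θ0) := ⟨_, rfl⟩
  have hε0 : 0 ≤ ε := by rw [hε]; positivity
  have hkε : ∀ i u, -ε ≤ kTD p g Vhat i u := by
    intro i u
    rcases le_or_gt 0 (kTD p g Vhat i u) with h | h
    · linarith
    · have hbd : ∀ v, Real.exp (θhat (i, v)) * kTD p g Vhat i v ≤ Real.exp (-θ0) * C := by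
        intro v
        rcases le_or_gt (kTD p g Vhat i v) 0 with h' | h'
        · have := mul_nonpos_of_nonneg_of_nonpos (Real.exp_pos (θhat (i, v))).le h'
          have : 0 ≤ Real.exp (-θ0) * C := by positivity
          linarith
        · rw [heq2 i v h']
          exact mul_le_mul_of_nonneg_left (hk i v) (Real.exp_pos _).le
      classical
      have hs := hsum i
      rw [← Finset.add_sum_erase _ _ (Finset.mem_univ u), heq1 i u h] at hs
      have h1 : ∑ v ∈ Finset.univ.erase u, Real.exp (θhat (i, v)) * kTD p g Vhat i v
          ≤ (Fintype.card A : ℝ) * (Real.exp (-θ0) * C) := by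
        refine (Finset.sum_le_card_nsmul _ _ _ (fun v _ => hbd v)).trans ?_
        rw [nsmul_eq_mul]
        refine mul_le_mul_of_nonneg_right ?_ (by positivity)
        exact_mod_cast Finset.card_le_univ _
      have hee : Real.exp (2 * θ0) = Real.exp θ0 * Real.exp θ0 := by
        rw [← Real.exp_add]; ring_nf
      have he : Real.exp θ0 * Real.exp (-θ0) = 1 := by
        rw [← Real.exp_add]; simp
      have h2 : -kTD p g Vhat i u ≤ ε := by
        rw [hε, le_div_iff₀ (Real.exp_pos _), hee]
        have h3 : Real.exp θ0 * -kTD p g Vhat i u ≤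
            (Fintype.card A : ℝ) * (Real.exp (-θ0) * C) := by linarith
        calc -kTD p g Vhat i u * (Real.exp θ0 * Real.exp θ0)
            = Real.exp θ0 * (Real.exp θ0 * -kTD p g Vhat i u) := by ring
          _ ≤ Real.exp θ0 * ((Fintype.card A : ℝ) * (Real.exp (-θ0) * C)) :=
              mul_le_mul_of_nonneg_left h3 (Real.exp_pos _).le
          _ = (Real.exp θ0 * Real.exp (-θ0)) * (C * (Fintype.card A : ℝ)) := by ring
          _ = C * (Fintype.card A : ℝ) := by rw [he, one_mul]
      linarith
  have hS1 : ∀ i u, Vstar i ≤ g i u + ∑ j, p i u j * Vstar j := by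
    intro i u
    exact (congrFun hVstar i).symm.le.trans
      (Finset.inf'_le (fun u => g i u + ∑ j, p i u j * Vstar j) (Finset.mem_univ u))
  have hS2 : ∀ i, ∃ u, Vstar i = g i u + ∑ j, p i u j * Vstar j := by
    intro i
    obtain ⟨u, _, hu⟩ := Finset.exists_mem_eq_inf' (Finset.univ_nonempty (α := A))
      (fun u => g i u + ∑ j, p i u j * Vstar j)
    exact ⟨u, (congrFun hVstar i).symm.trans hu⟩
  have hD1 : ∀ i, Vhat i - Vstar i ≤ ε * ξ i := by
    refine aux_le p hp ξ hξ1 hξ ε hε0 (fun i => Vhat i - Vstar i) fun i => ?_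
    obtain ⟨u, hu⟩ := hS2 i
    refine ⟨u, ?_⟩
    have := hkε i u
    unfold kTD at this
    simp only [mul_sub, Finset.sum_sub_distrib]
    linarith
  have hD2 : ∀ i, Vstar i - Vhat i ≤ 0 * ξ i := by
    refine aux_le p hp ξ hξ1 hξ 0 le_rfl (fun i => Vstar i - Vhat i) fun i => ?_
    obtain ⟨u, hu⟩ := hle i
    refine ⟨u, ?_⟩
    have := hS1 i u
    unfold kTD at hu
    simp only [mul_sub, Finset.sum_sub_distrib]
    linarith
  have hβlt : betaXi ξ < 1 := by
    unfold betaXi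
    rw [Finset.sup'_lt_iff]
    intro i _
    rw [div_lt_one (lt_of_lt_of_le one_pos (hξ1 i))]
    linarith
  have hmin1 : 1 ≤ xiMin ξ := by
    unfold xiMin
    exact Finset.le_inf' _ _ fun i _ => hξ1 i
  have hprod : xiMin ξ * (1 - betaXi ξ) ≤ 1 := by
    obtain ⟨i⟩ := ‹Nonempty S›
    have h1 : xiMin ξ ≤ ξ i := Finset.inf'_le ξ (Finset.mem_univ i)
    have h2 : (ξ i - 1) / ξ i ≤ betaXi ξ :=
      Finset.le_sup' (fun i => (ξ i - 1) / ξ i) (Finset.mem_univ i)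
    rw [div_le_iff₀ (lt_of_lt_of_le one_pos (hξ1 i))] at h2
    nlinarith
  have hprod0 : 0 < xiMin ξ * (1 - betaXi ξ) := mul_pos (by linarith) (by linarith)
  intro i
  have h1 : |Vhat i - Vstar i| ≤ ε * xiMax ξ := by
    have := mul_le_mul_of_nonneg_left (hmax i) hε0
    have h3 := hD1 i
    have h4 := hD2 i
    rw [abs_le]
    constructor <;> nlinarith
  refine h1.trans ?_
  have h2 : xiMax ξ * B * (1 + 2 * xiMax ξ) * (Fintype.card A : ℝ) /
        (xiMin ξ * Real.exp (2 * θ0) * (1 - betaXi ξ))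
      = (ε * xiMax ξ) / (xiMin ξ * (1 - betaXi ξ)) := by
    rw [hε, hC, div_mul_eq_mul_div, div_div]
    congr 1 <;> ring
  rw [h2, le_div_iff₀ hprod0]
  exact mul_le_of_le_one_right (mul_nonneg hε0 (by linarith)) hprod
end

section
/- Let ξ be a weight vector. For every ε > 0 there exists θ̄ > 0 such that for all θ0 ≥ θ̄ the following holds: if θ̂ : S⁻ × A → ℝ satisfies |θ̂(i,u)| ≤ θ0 for all (i,u), V̂ : S⁻ → ℝ satisfies V̂ = T_{π_{θ̂}} V̂ for the softmax policy π_{θ̂}, the equilibrium conditions hold (for all (i,u): θ̂(i,u) = θ0 whenever k_{iu}(V̂) < 0 and θ̂(i,u) = −θ0 whenever k_{iu}(V̂) > 0), and V* : S⁻ → ℝ satisfies T V* = V*, then V*(i) − ε ≤ V̂(i) ≤ V*(i) + ε for all i ∈ S⁻. -/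
/-- Weighted comparison principle. -/
theorem comparison_aux {S A : Type*} [Fintype S] [Nonempty S]
    (p : S → A → S → ℝ) (hp : ∀ i u j, 0 ≤ p i u j)
    (ξ : S → ℝ) (hξ1 : ∀ i, 1 ≤ ξ i)
    (hξ : ∀ i u, 1 + ∑ j, p i u j * ξ j ≤ ξ i)
    (c : ℝ) (hc : 0 ≤ c) (D : S → ℝ)
    (hD : ∀ i, ∃ u, D i ≤ ∑ j, p i u j * D j + c) (i : S) : D i ≤ c * ξ i := by
  have hpos : ∀ i, 0 < ξ i := fun i => lt_of_lt_of_le one_pos (hξ1 i)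
  obtain ⟨m, hm⟩ := Finite.exists_max (fun i => D i / ξ i)
  have hall : ∀ j, D j ≤ D m / ξ m * ξ j := fun j => (div_le_iff₀ (hpos j)).1 (hm j)
  have hle : D m / ξ m ≤ c := by
    by_contra hlt
    push Not at hlt
    set M := D m / ξ m with hM
    have hDm : D m = M * ξ m := by rw [hM, div_mul_cancel₀ _ (hpos m).ne']
    obtain ⟨u, hu⟩ := hD m
    have h1 : ∑ j, p m u j * D j ≤ M * ∑ j, p m u j * ξ j := by
      rw [Finset.mul_sum]
      apply Finset.sum_le_sum
      intro j _
      have := mul_le_mul_of_nonneg_left (hall j) (hp m u j)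
      linarith
    have h2 := mul_le_mul_of_nonneg_left (hξ m u) (hc.trans hlt.le)
    linarith
  exact (hall i).trans (mul_le_mul_of_nonneg_right hle (hpos i).le)

/-- Lemma 7 of the paper: for every `ε > 0` there exists `θ̄ > 0` such that for
all `θ0 ≥ θ̄`, every stable actor equilibrium `(θ̂, V̂)` with `|θ̂| ≤ θ0` is `ε`-optimal:
`V*(i) − ε ≤ V̂(i) ≤ V*(i) + ε` for all `i`. -/
theorem stmt_11 {S A : Type*} [Fintype S] [Fintype A] [Nonempty S] [Nonempty A]
    (p : S → A → S → ℝ)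
    (hp : ∀ i u j, 0 ≤ p i u j) (hps : ∀ i u, ∑ j, p i u j ≤ 1)
    (g : S → A → ℝ) (B : ℝ) (hB : 0 ≤ B) (hg : ∀ i u, |g i u| ≤ B)
    (ξ : S → ℝ) (hξ1 : ∀ i, 1 ≤ ξ i)
    (hξ : ∀ i u, 1 + ∑ j, p i u j * ξ j ≤ ξ i)
    (ε : ℝ) (hε : 0 < ε) :
    ∃ θbar : ℝ, 0 < θbar ∧ ∀ θ0 : ℝ, θbar ≤ θ0 →
      ∀ (θhat : S × A → ℝ), (∀ i u, |θhat (i, u)| ≤ θ0) →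
      ∀ (Vhat : S → ℝ), Vhat = Tpol p g (softmax θhat) Vhat →
      (∀ i u, kTD p g Vhat i u < 0 → θhat (i, u) = θ0) →
      (∀ i u, 0 < kTD p g Vhat i u → θhat (i, u) = -θ0) →
      ∀ (Vstar : S → ℝ), Topt p g Vstar = Vstar →
      ∀ i, Vstar i - ε ≤ Vhat i ∧ Vhat i ≤ Vstar i + ε := by
  classical
  set X : ℝ := ∑ i, ξ i with hX
  have hpos : ∀ i, 0 < ξ i := fun i => lt_of_lt_of_le one_pos (hξ1 i)
  have hξX : ∀ i, ξ i ≤ X := fun i =>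
    Finset.single_le_sum (f := ξ) (fun j _ => (hpos j).le) (Finset.mem_univ i)
  have hXpos : 0 < X := (hpos (Classical.arbitrary S)).trans_le (hξX _)
  set δ : ℝ := ε / X with hδ
  have hδpos : 0 < δ := div_pos hε hXpos
  set K : ℝ := 2 * B * X with hK
  have hK0 : 0 ≤ K := by positivity
  set n : ℝ := (Fintype.card A : ℝ) with hn
  have hn0 : 0 ≤ n := by positivity
  refine ⟨n * K / δ + 1, by positivity, ?_⟩
  intro θ0 hθ θhat hbd Vhat hV hneg hposk Vstar hstar
  -- the weighted sum of the TD terms vanishes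
  have hsum : ∀ i, ∑ u, Real.exp (θhat (i, u)) * kTD p g Vhat i u = 0 := by
    intro i
    have hZ : 0 < ∑ u, Real.exp (θhat (i, u)) :=
      Finset.sum_pos (fun u _ => Real.exp_pos _) Finset.univ_nonempty
    have h := congrFun hV i
    have h2 : Vhat i * ∑ u, Real.exp (θhat (i, u)) =
        ∑ u, Real.exp (θhat (i, u)) * (g i u + ∑ j, p i u j * Vhat j) := by
      have h3 : Tpol p g (softmax θhat) Vhat i =
          (∑ u, Real.exp (θhat (i, u)) * (g i u + ∑ j, p i u j * Vhat j)) /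
            ∑ u, Real.exp (θhat (i, u)) := by
        simp only [Tpol, softmax]
        rw [Finset.sum_div]
        exact Finset.sum_congr rfl (fun u _ => by ring)
      rw [h3] at h
      exact (eq_div_iff hZ.ne').1 h
    simp only [kTD, mul_sub, Finset.sum_sub_distrib]
    rw [← Finset.sum_mul, ← h2]
    ring
  have hex1 : ∀ i, ∃ u, 0 ≤ kTD p g Vhat i u := by
    intro i
    by_contra hcon
    push Not at hcon
    have : ∑ u, Real.exp (θhat (i, u)) * kTD p g Vhat i u < 0 :=
      Finset.sum_neg (fun u _ => mul_neg_of_pos_of_neg (Real.exp_pos _) (hcon u))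
        Finset.univ_nonempty
    linarith [hsum i]
  have hex2 : ∀ i, ∃ u, kTD p g Vhat i u ≤ 0 := by
    intro i
    by_contra hcon
    push Not at hcon
    have : 0 < ∑ u, Real.exp (θhat (i, u)) * kTD p g Vhat i u :=
      Finset.sum_pos (fun u _ => mul_pos (Real.exp_pos _) (hcon u))
        Finset.univ_nonempty
    linarith [hsum i]
  have hup : ∀ i, Vhat i ≤ B * ξ i := by
    apply comparison_aux p hp ξ hξ1 hξ B hB
    intro i
    obtain ⟨u, hu⟩ := hex1 i
    refine ⟨u, ?_⟩
    simp only [kTD] at hu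
    linarith [(abs_le.1 (hg i u)).2]
  have hlo : ∀ i, -Vhat i ≤ B * ξ i := by
    apply comparison_aux p hp ξ hξ1 hξ B hB (fun i => -Vhat i)
    intro i
    obtain ⟨u, hu⟩ := hex2 i
    refine ⟨u, ?_⟩
    simp only [kTD] at hu
    simp only [mul_neg, Finset.sum_neg_distrib]
    linarith [(abs_le.1 (hg i u)).1]
  have hkK : ∀ i u, kTD p g Vhat i u ≤ K := by
    intro i u
    have h1 : ∑ j, p i u j * Vhat j ≤ B * ∑ j, p i u j * ξ j := by
      rw [Finset.mul_sum]
      apply Finset.sum_le_sum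
      intro j _
      have := mul_le_mul_of_nonneg_left (hup j) (hp i u j)
      linarith
    have h2 := mul_le_mul_of_nonneg_left (hξ i u) hB
    have h3 := mul_le_mul_of_nonneg_left (hξX i) hB
    have h4 := hlo i
    have h5 := (abs_le.1 (hg i u)).2
    simp only [kTD]
    linarith
  have hkδ : ∀ i u, -δ ≤ kTD p g Vhat i u := by
    intro i u
    by_contra hcon
    push Not at hcon
    have hku : kTD p g Vhat i u < 0 := by linarith
    have hE : 0 < Real.exp θ0 := Real.exp_pos _
    have hE' : 0 < Real.exp (-θ0) := Real.exp_pos _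
    have hEE : Real.exp θ0 * Real.exp (-θ0) = 1 := by
      rw [← Real.exp_add]; simp
    have hle : ∑ u', Real.exp (θhat (i, u')) * kTD p g Vhat i u' ≤
        ∑ u', (Real.exp (-θ0) * K +
          if u' = u then Real.exp θ0 * kTD p g Vhat i u else 0) := by
      apply Finset.sum_le_sum
      intro u' _
      have hnn : 0 ≤ Real.exp (-θ0) * K := by positivity
      split_ifs with heq
      · subst heq
        rw [hneg i u' hku]
        linarith
      · rcases le_or_gt (kTD p g Vhat i u') 0 with h | h
        · have := mul_nonpos_of_nonneg_of_nonpos (Real.exp_pos (θhat (i, u'))).le h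
          linarith
        · rw [hposk i u' h]
          have := mul_le_mul_of_nonneg_left (hkK i u') hE'.le
          linarith
    rw [hsum i, Finset.sum_add_distrib, Finset.sum_ite_eq' Finset.univ u] at hle
    simp only [Finset.sum_const, Finset.card_univ, nsmul_eq_mul, Finset.mem_univ,
      if_true] at hle
    rw [← hn] at hle
    have hq : 0 ≤ n * K / δ := by positivity
    have h1 : θ0 + 1 ≤ Real.exp θ0 := Real.add_one_le_exp _
    have h2 : n * K ≤ Real.exp θ0 * δ := by
      rw [← div_le_iff₀ hδpos]; linarith
    have h3 : Real.exp (-θ0) * (n * K) ≤ δ := by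
      have := mul_le_mul_of_nonneg_left h2 hE'.le
      calc _ ≤ _ := this
        _ = (Real.exp θ0 * Real.exp (-θ0)) * δ := by ring
        _ = δ := by rw [hEE, one_mul]
    have h4 : Real.exp θ0 * kTD p g Vhat i u ≤ kTD p g Vhat i u := by
      nlinarith
    linarith
  intro i
  constructor
  · have := comparison_aux p hp ξ hξ1 hξ 0 le_rfl (fun i => Vstar i - Vhat i) (by
      intro i
      obtain ⟨u, hu⟩ := hex2 i
      refine ⟨u, ?_⟩
      have hs : Vstar i ≤ g i u + ∑ j, p i u j * Vstar j := by
        conv_lhs => rw [← hstar]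
        exact Finset.inf'_le _ (Finset.mem_univ u)
      simp only [kTD] at hu
      simp only [mul_sub, Finset.sum_sub_distrib]
      linarith) i
    simp only [zero_mul] at this
    linarith
  · have := comparison_aux p hp ξ hξ1 hξ δ hδpos.le (fun i => Vhat i - Vstar i) (by
      intro i
      obtain ⟨u, _, hu⟩ := Finset.exists_mem_eq_inf' (Finset.univ_nonempty (α := A))
        (fun u => g i u + ∑ j, p i u j * Vstar j)
      have hs : Vstar i = g i u + ∑ j, p i u j * Vstar j := by
        conv_lhs => rw [← hstar]
        exact hu
      refine ⟨u, ?_⟩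
      have hk := hkδ i u
      simp only [kTD] at hk
      simp only [mul_sub, Finset.sum_sub_distrib]
      linarith) i
    have h2 := mul_le_mul_of_nonneg_left (hξX i) hδpos.le
    have h3 : δ * X = ε := div_mul_cancel₀ _ hXpos.ne'
    linarith
end

section
/- Let θ0 > 0 and let Γ_{θ0} : ℝ → ℝ be the clamp map Γ_{θ0}(x) = min(θ0, max(−θ0, x)). Fix V : S⁻ → ℝ and θ : S⁻ × A → ℝ with |θ(i,u)| ≤ θ0 for all (i,u). Then the following are equivalent: (a) for every (i,u) ∈ S⁻ × A, the quotient (Γ_{θ0}(θ(i,u) + δ·(−k_{iu}(V))) − θ(i,u))/δ tends to 0 as δ → 0 from the right; (b) θ belongs to the set Θ(V), i.e., for every (i,u): θ(i,u) = θ0 whenever k_{iu}(V) < 0, and θ(i,u) = −θ0 whenever k_{iu}(V) > 0. -/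
theorem clamp_aux (c t k : ℝ) (hc : 0 < c) (hb : |t| ≤ c) :
    Filter.Tendsto (fun δ : ℝ => (min c (max (-c) (t + δ * (-k))) - t) / δ)
        (nhdsWithin 0 (Set.Ioi 0)) (nhds 0) ↔
      ((k < 0 → t = c) ∧ (0 < k → t = -c)) := by
  obtain ⟨h1, h2⟩ := abs_le.mp hb
  constructor
  · intro h
    have key : ∀ e : ℝ, 0 < e →
        (∀ δ : ℝ, 0 < δ → δ < e → min c (max (-c) (t + δ * (-k))) = t + δ * (-k)) → k = 0 := by
      intro e he H
      have h' : Filter.Tendsto (fun δ : ℝ => (min c (max (-c) (t + δ * (-k))) - t) / δ)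
          (nhdsWithin 0 (Set.Ioi 0)) (nhds (-k)) := by
        refine tendsto_const_nhds.congr' ?_
        filter_upwards [Ioo_mem_nhdsGT he] with δ hδ
        rw [H δ hδ.1 hδ.2]
        have := hδ.1.ne'
        field_simp
        ring
      have := tendsto_nhds_unique h h'
      linarith
    constructor
    · intro hk
      by_contra hne
      have hlt : t < c := lt_of_le_of_ne h2 hne
      have := key ((c - t) / (-k)) (div_pos (by linarith) (by linarith)) (by
        intro δ h0 hd
        rw [lt_div_iff₀ (by linarith)] at hd
        have : 0 < δ * (-k) := mul_pos h0 (by linarith)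
        rw [max_eq_right (by linarith), min_eq_right (by linarith)])
      linarith
    · intro hk
      by_contra hne
      have hlt : -c < t := lt_of_le_of_ne h1 (Ne.symm hne)
      have := key ((t + c) / k) (div_pos (by linarith) hk) (by
        intro δ h0 hd
        rw [lt_div_iff₀ hk] at hd
        have : 0 < δ * k := mul_pos h0 hk
        rw [max_eq_right (by linarith), min_eq_right (by linarith)])
      linarith
  · rintro ⟨ha, hb'⟩
    refine tendsto_const_nhds.congr' ?_
    filter_upwards [self_mem_nhdsWithin] with δ hδ
    have hδ : 0 < δ := hδ
    have : min c (max (-c) (t + δ * (-k))) = t := by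
      rcases lt_trichotomy k 0 with hk | hk | hk
      · have h3 := ha hk
        have : 0 < δ * (-k) := mul_pos hδ (by linarith)
        rw [max_eq_right (by linarith), min_eq_left (by linarith), h3]
      · subst hk
        simp [h1, h2]
      · have h3 := hb' hk
        have : 0 < δ * k := mul_pos hδ hk
        rw [max_eq_left (by linarith), min_eq_right (by linarith), h3]
    rw [this]; simp

/-- For the clamp map `Γ_{θ0}(x) = min(θ0, max(−θ0, x))` and `|θ(i,u)| ≤ θ0`,
the directional derivative `Γ̄_{θ0}(θ(i,u); −k_{iu}(V))` vanishes for all `(i,u)` iff `θ`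
belongs to the equilibrium set `Θ(V)`: `θ(i,u) = θ0` whenever `k_{iu}(V) < 0` and
`θ(i,u) = −θ0` whenever `k_{iu}(V) > 0`. -/
theorem stmt_12 {S A : Type*} [Fintype S] [Fintype A] [Nonempty S] [Nonempty A]
    (p : S → A → S → ℝ)
    (hp : ∀ i u j, 0 ≤ p i u j) (hps : ∀ i u, ∑ j, p i u j ≤ 1)
    (g : S → A → ℝ) (B : ℝ) (hB : 0 ≤ B) (hg : ∀ i u, |g i u| ≤ B)
    (θ0 : ℝ) (hθ0 : 0 < θ0)
    (V : S → ℝ) (θ : S × A → ℝ) (hb : ∀ i u, |θ (i, u)| ≤ θ0) :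
    ((∀ i u, Filter.Tendsto
        (fun δ : ℝ =>
          (min θ0 (max (-θ0) (θ (i, u) + δ * (-(kTD p g V i u)))) - θ (i, u)) / δ)
        (nhdsWithin 0 (Set.Ioi 0)) (nhds 0)) ↔
      (∀ i u, (kTD p g V i u < 0 → θ (i, u) = θ0) ∧
              (0 < kTD p g V i u → θ (i, u) = -θ0))) := by
  exact forall_congr' fun i => forall_congr' fun u => clamp_aux θ0 _ _ hθ0 (hb i u)
end

section
/- Let n and d be finite nonempty index sets. Let P be an n×n real matrix with nonnegative entries and row sums at most 1. Let h0, h : n → ℝ satisfy h0(j) > 0 for all j, h(j) ≥ 0 for all j, and the balance equations h(j) = h0(j) + ∑_{i} h(i) P(i,j) for all j. Let H be the diagonal matrix with diagonal entries h, and let Φ be an n×d real matrix whose columns are linearly independent (i.e., Φ v = 0 implies v = 0 for v : d → ℝ). Then the matrix Φ^T H (P − I) Φ is negative definite: for every nonzero v : d → ℝ, v^T Φ^T H (P − I) Φ v < 0. -/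
open Matrix

/-- If `P` is substochastic, `h0 > 0`, `h ≥ 0` satisfy the balance equations
`h(j) = h0(j) + ∑_i h(i) P(i,j)`, `H = diag(h)`, and `Φ` has linearly independent columns,
then `Φᵀ H (P − I) Φ` is negative definite. -/
theorem stmt_16 {n d : Type*} [Fintype n] [Fintype d] [Nonempty n] [Nonempty d] [DecidableEq n]
    (P : Matrix n n ℝ)
    (hP : ∀ i j, 0 ≤ P i j) (hrow : ∀ i, ∑ j, P i j ≤ 1)
    (h0 h : n → ℝ) (hh0 : ∀ j, 0 < h0 j) (hh : ∀ j, 0 ≤ h j)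
    (hbal : ∀ j, h j = h0 j + ∑ i, h i * P i j)
    (Φ : Matrix n d ℝ) (hΦ : ∀ v : d → ℝ, Φ.mulVec v = 0 → v = 0) :
    ∀ v : d → ℝ, v ≠ 0 →
      v ⬝ᵥ (Φᵀ * Matrix.diagonal h * (P - 1) * Φ).mulVec v < 0 := by
  intro v hv
  set x := Φ.mulVec v with hx
  have hx0 : x ≠ 0 := fun h => hv (hΦ v h)
  have e : v ⬝ᵥ (Φᵀ * Matrix.diagonal h * (P - 1) * Φ).mulVec v
      = (∑ i, ∑ j, h i * P i j * (x i * x j)) - ∑ i, h i * x i ^ 2 := by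
    rw [← Matrix.mulVec_mulVec, ← hx, Matrix.mul_assoc, ← Matrix.mulVec_mulVec,
      Matrix.dotProduct_mulVec, Matrix.vecMul_transpose, ← hx, ← Matrix.mulVec_mulVec,
      Matrix.sub_mulVec, Matrix.one_mulVec]
    simp only [dotProduct, Matrix.mulVec_diagonal, Pi.sub_apply]
    rw [← Finset.sum_sub_distrib]
    refine Finset.sum_congr rfl fun i _ => ?_
    have : ∑ j, h i * P i j * (x i * x j) = x i * h i * (P.mulVec x) i := by
      simp only [Matrix.mulVec, dotProduct, Finset.mul_sum]
      exact Finset.sum_congr rfl fun j _ => by ring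
    rw [this]; ring
  have h1 : ∑ i, ∑ j, h i * P i j * (x i * x j)
      ≤ ∑ i, ∑ j, (h i * P i j * x i ^ 2 / 2 + h i * P i j * x j ^ 2 / 2) := by
    refine Finset.sum_le_sum fun i _ => Finset.sum_le_sum fun j _ => ?_
    nlinarith [mul_nonneg (mul_nonneg (hh i) (hP i j)) (sq_nonneg (x i - x j))]
  simp only [Finset.sum_add_distrib] at h1
  have h2 : ∑ i, ∑ j, h i * P i j * x i ^ 2 / 2 ≤ ∑ i, h i * x i ^ 2 / 2 := by
    refine Finset.sum_le_sum fun i _ => ?_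
    have : ∑ j, h i * P i j * x i ^ 2 / 2 = h i * x i ^ 2 / 2 * ∑ j, P i j := by
      rw [Finset.mul_sum]
      exact Finset.sum_congr rfl fun j _ => by ring
    rw [this]
    exact mul_le_of_le_one_right (by have := hh i; positivity) (hrow i)
  have h3 : ∑ i, ∑ j, h i * P i j * x j ^ 2 / 2
      = ∑ j, h j * x j ^ 2 / 2 - ∑ j, h0 j * x j ^ 2 / 2 := by
    rw [Finset.sum_comm, ← Finset.sum_sub_distrib]
    refine Finset.sum_congr rfl fun j _ => ?_
    have : ∑ i, h i * P i j * x j ^ 2 / 2 = (∑ i, h i * P i j) * (x j ^ 2 / 2) := by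
      rw [Finset.sum_mul]
      exact Finset.sum_congr rfl fun i _ => by ring
    rw [this]
    have hb := hbal j
    have : ∑ i, h i * P i j = h j - h0 j := by linarith
    rw [this]; ring
  have h4 : 0 < ∑ j, h0 j * x j ^ 2 / 2 := by
    obtain ⟨k, hk⟩ := Function.ne_iff.mp hx0
    refine Finset.sum_pos' (fun j _ => by have := hh0 j; positivity) ⟨k, Finset.mem_univ _, ?_⟩
    have hk' : x k ≠ 0 := hk
    have := hh0 k
    positivity
  have h5 : ∑ i, h i * x i ^ 2 = 2 * ∑ i, h i * x i ^ 2 / 2 := by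
    rw [Finset.mul_sum]
    exact Finset.sum_congr rfl fun i _ => by ring
  rw [e]
  linarith
end

section
/- Let d be a finite nonempty index set, let M be a d×d real matrix such that x^T M x < 0 for every nonzero x : d → ℝ, and let b : d → ℝ. Then M is invertible, v* := −M^{-1} b is the unique solution of M v + b = 0, and every differentiable function v : ℝ → (d → ℝ) satisfying v'(t) = M·v(t) + b for all t ≥ 0 converges to v* as t → ∞; i.e., v* is the unique globally asymptotically stable equilibrium of the ODE dv/dt = M v + b. -/
open Matrix

theorem coercive_aux {d : Type*} [Fintype d] [Nonempty d]
    (M : Matrix d d ℝ)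
    (hM : ∀ x : d → ℝ, x ≠ 0 → x ⬝ᵥ M.mulVec x < 0) :
    ∃ c : ℝ, 0 < c ∧ ∀ x : d → ℝ, x ⬝ᵥ M.mulVec x ≤ -c * (x ⬝ᵥ x) := by
  have hcont : Continuous (fun x : d → ℝ => x ⬝ᵥ M.mulVec x) := by
    simp only [dotProduct, Matrix.mulVec]
    fun_prop
  obtain ⟨x0, hx0, hmax⟩ := (isCompact_sphere (0 : d → ℝ) 1).exists_isMaxOn
    (NormedSpace.sphere_nonempty.2 zero_le_one) hcont.continuousOn
  have hx0n : ‖x0‖ = 1 := by simpa using hx0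
  have hx0' : x0 ≠ 0 := by
    rintro rfl
    simp at hx0n
  have hm := hM x0 hx0'
  set m := x0 ⬝ᵥ M.mulVec x0 with hmdef
  have hn : (0 : ℝ) < Fintype.card d := by exact_mod_cast Fintype.card_pos
  refine ⟨-m / Fintype.card d, div_pos (by linarith) hn, fun x => ?_⟩
  by_cases hx : x = 0
  · simp [hx]
  have hxn : 0 < ‖x‖ := norm_pos_iff.2 hx
  have h1 : (‖x‖⁻¹ • x) ⬝ᵥ M.mulVec (‖x‖⁻¹ • x) ≤ m := by
    apply hmax
    simp [norm_smul, hxn.ne']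
  rw [Matrix.mulVec_smul, smul_dotProduct, dotProduct_smul, smul_eq_mul, smul_eq_mul] at h1
  have h2 : x ⬝ᵥ M.mulVec x ≤ m * ‖x‖ ^ 2 := by
    have := mul_le_mul_of_nonneg_right h1 (sq_nonneg ‖x‖)
    field_simp at this
    linarith
  have h3 : x ⬝ᵥ x ≤ Fintype.card d * ‖x‖ ^ 2 := by
    have : ∀ i ∈ Finset.univ, x i * x i ≤ ‖x‖ ^ 2 := by
      intro i _
      have := norm_le_pi_norm x i
      rw [Real.norm_eq_abs] at this
      rw [← pow_two, ← sq_abs]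
      gcongr
    have := Finset.sum_le_card_nsmul _ _ _ this
    simpa [dotProduct] using this
  have h4 : m / Fintype.card d * (Fintype.card d * ‖x‖ ^ 2) ≤ m / Fintype.card d * (x ⬝ᵥ x) :=
    mul_le_mul_of_nonpos_left h3 (div_nonpos_of_nonpos_of_nonneg hm.le hn.le)
  have h5 : m / Fintype.card d * (Fintype.card d * ‖x‖ ^ 2) = m * ‖x‖ ^ 2 := by field_simp
  have h6 : -(-m / Fintype.card d) * (x ⬝ᵥ x) = m / Fintype.card d * (x ⬝ᵥ x) := by ring
  linarith

/-- If the real matrix `M` has a negative-definite quadratic form, then `M` is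
invertible, `v* = −M⁻¹ b` is the unique solution of `M v + b = 0`, and every differentiable
solution of the ODE `v' = M v + b` (for `t ≥ 0`) converges to `v*` as `t → ∞`. -/
theorem stmt_17 {d : Type*} [Fintype d] [Nonempty d] [DecidableEq d]
    (M : Matrix d d ℝ)
    (hM : ∀ x : d → ℝ, x ≠ 0 → x ⬝ᵥ M.mulVec x < 0)
    (b : d → ℝ) :
    IsUnit M ∧
    (∀ v : d → ℝ, (M.mulVec v + b = 0 ↔ v = -(M⁻¹.mulVec b))) ∧
    (∀ v : ℝ → (d → ℝ), Differentiable ℝ v →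
      (∀ t : ℝ, 0 ≤ t → deriv v t = M.mulVec (v t) + b) →
      Filter.Tendsto v Filter.atTop (nhds (-(M⁻¹.mulVec b)))) := by
  have hU : IsUnit M := by
    rw [← Matrix.mulVec_injective_iff_isUnit]
    intro x y hxy
    by_contra hne
    have := hM (x - y) (sub_ne_zero.2 hne)
    have hxy' : M.mulVec x = M.mulVec y := hxy
    rw [Matrix.mulVec_sub, hxy', sub_self, dotProduct_zero] at this
    exact lt_irrefl _ this
  have hdet : IsUnit M.det := (Matrix.isUnit_iff_isUnit_det M).1 hU
  have heq : M.mulVec (-(M⁻¹.mulVec b)) + b = 0 := by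
    rw [Matrix.mulVec_neg, Matrix.mulVec_mulVec, Matrix.mul_nonsing_inv _ hdet, Matrix.one_mulVec]
    simp
  refine ⟨hU, fun v => ⟨fun h => ?_, fun h => by rw [h]; exact heq⟩, ?_⟩
  · apply Matrix.mulVec_injective_iff_isUnit.2 hU
    exact add_right_cancel (h.trans heq.symm)
  intro v hv hode
  obtain ⟨c, hc, hcoer⟩ := coercive_aux M hM
  set s := -(M⁻¹.mulVec b) with hs
  let W : ℝ → ℝ := fun t => (v t - s) ⬝ᵥ (v t - s)
  have hW : ∀ t, HasDerivAt W (2 * ((v t - s) ⬝ᵥ deriv v t)) t := by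
    intro t
    have h1 : ∀ i, HasDerivAt (fun t => v t i - s i) (deriv v t i) t := fun i =>
      ((hasDerivAt_pi.1 (hv t).hasDerivAt) i).sub_const _
    have h2 := HasDerivAt.fun_sum (u := Finset.univ) (fun i _ => (h1 i).mul (h1 i))
    refine h2.congr_deriv ?_
    simp only [dotProduct, Finset.mul_sum, Pi.sub_apply]
    exact Finset.sum_congr rfl fun i _ => by ring
  have hG : ∀ t, HasDerivAt (fun t => Real.exp (2 * c * t) * W t)
      (Real.exp (2 * c * t) * (2 * c) * W t
        + Real.exp (2 * c * t) * (2 * ((v t - s) ⬝ᵥ deriv v t))) t := by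
    intro t
    have h1 : HasDerivAt (fun t : ℝ => Real.exp (2 * c * t)) (Real.exp (2 * c * t) * (2 * c)) t := by
      simpa using ((hasDerivAt_id t).const_mul (2 * c)).exp
    exact h1.mul (hW t)
  have hanti : AntitoneOn (fun t => Real.exp (2 * c * t) * W t) (Set.Ici 0) := by
    apply antitoneOn_of_deriv_nonpos (convex_Ici 0)
    · exact fun t _ => (hG t).continuousAt.continuousWithinAt
    · exact fun t _ => (hG t).differentiableAt.differentiableWithinAt
    · intro t ht
      rw [interior_Ici] at ht
      have ht' : (0 : ℝ) ≤ t := le_of_lt ht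
      rw [(hG t).deriv]
      have h1 : deriv v t = M.mulVec (v t - s) := by
        rw [hode t ht', Matrix.mulVec_sub, eq_neg_of_add_eq_zero_left heq, sub_neg_eq_add]
      rw [h1]
      have h2 := hcoer (v t - s)
      have h3 : c * W t + (v t - s) ⬝ᵥ M.mulVec (v t - s) ≤ 0 := by
        simp only [W]; linarith
      have h4 := mul_nonpos_of_nonneg_of_nonpos (Real.exp_pos (2 * c * t)).le h3
      nlinarith [h4]
  have hbound : ∀ t, 0 ≤ t → W t ≤ W 0 * Real.exp (-(2 * c * t)) := by
    intro t ht
    have h := hanti (Set.mem_Ici.2 le_rfl) (Set.mem_Ici.2 ht) ht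
    simp only [mul_zero, Real.exp_zero, one_mul] at h
    rw [Real.exp_neg, ← div_eq_mul_inv, le_div_iff₀ (Real.exp_pos _)]
    linarith
  have hlim : Filter.Tendsto (fun t => W 0 * Real.exp (-(2 * c * t))) Filter.atTop (nhds 0) := by
    have h1 : Filter.Tendsto (fun t : ℝ => 2 * c * t) Filter.atTop Filter.atTop :=
      Filter.tendsto_id.const_mul_atTop (by positivity)
    simpa using (Real.tendsto_exp_neg_atTop_nhds_zero.comp h1).const_mul (W 0)
  rw [tendsto_pi_nhds]
  intro i
  have hsq : Filter.Tendsto (fun t => (v t i - s i) ^ 2) Filter.atTop (nhds 0) := by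
    refine squeeze_zero' (Filter.Eventually.of_forall fun t => sq_nonneg _) ?_ hlim
    filter_upwards [Filter.eventually_ge_atTop 0] with t ht
    refine le_trans ?_ (hbound t ht)
    have := Finset.single_le_sum (f := fun j => (v t - s) j * (v t - s) j)
      (fun j _ => mul_self_nonneg _) (Finset.mem_univ i)
    rw [pow_two]
    exact this
  have habs : Filter.Tendsto (fun t => |v t i - s i|) Filter.atTop (nhds 0) := by
    have := (Real.continuous_sqrt.tendsto 0).comp hsq
    simpa [Function.comp_def, Real.sqrt_sq_eq_abs] using this
  exact tendsto_sub_nhds_zero_iff.1 ((tendsto_zero_iff_abs_tendsto_zero _).2 habs)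
end
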